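/- arXiv:1507.00455 — 3 statements merged into one kernel-verified Lean document; each statement's English description precedes it below -/
import Mathlib

section
/- Let μ be a compactly supported Borel probability measure on ℝ, θ ∈ ℂ∖{0}, and δ > 0. Then the set {ξ ∈ ℂ : dist(ξ, supp(μ)) ≥ δ and G_μ(ξ) = 1/θ} is finite. -/
open MeasureTheory

/-- The (topological) support of a Borel measure on `ℝ`: the set of points all of whose
neighbourhoods have positive measure. -/
def measureSupport (μ : Measure ℝ) : Set ℝ := {x : ℝ | ∀ ε > 0, 0 < μ (Metric.ball x ε)}

/-- The Cauchy transform `G_μ(z) = ∫ 1/(z−x) dμ(x)` of a measure `μ` on `ℝ`. -/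
noncomputable def cauchyTransform (μ : Measure ℝ) (z : ℂ) : ℂ := ∫ x, (z - (x : ℂ))⁻¹ ∂μ

section CauchyTransform

variable {μ : Measure ℝ}

lemma ae_infDist_le_norm_sub_ofReal (hnull : μ (measureSupport μ)ᶜ = 0) :
    ∀ᵐ x : ℝ ∂μ, ∀ z : ℂ,
      Metric.infDist z (Complex.ofReal '' measureSupport μ) ≤ ‖z - (x : ℂ)‖ := by
  filter_upwards [mem_ae_iff.2 hnull] with x hx z
  rw [← dist_eq_norm]
  exact Metric.infDist_le_dist_of_mem (Set.mem_image_of_mem _ hx)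

lemma norm_cauchyTransform_le [IsProbabilityMeasure μ] (hnull : μ (measureSupport μ)ᶜ = 0)
    {z : ℂ} {r : ℝ} (hr : 0 < r)
    (hz : r ≤ Metric.infDist z (Complex.ofReal '' measureSupport μ)) :
    ‖cauchyTransform μ z‖ ≤ r⁻¹ := by
  have h : ∀ᵐ x : ℝ ∂μ, ‖(z - (x : ℂ))⁻¹‖ ≤ r⁻¹ := by
    filter_upwards [ae_infDist_le_norm_sub_ofReal hnull] with x hx
    rw [norm_inv]
    exact inv_anti₀ hr (hz.trans (hx z))
  simpa [cauchyTransform] using norm_integral_le_of_norm_le_const h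

lemma differentiableAt_cauchyTransform [IsFiniteMeasure μ] (hnull : μ (measureSupport μ)ᶜ = 0)
    {z : ℂ} (hz : 0 < Metric.infDist z (Complex.ofReal '' measureSupport μ)) :
    DifferentiableAt ℂ (cauchyTransform μ) z := by
  set d := Metric.infDist z (Complex.ofReal '' measureSupport μ) with hd
  have hmeas (w : ℂ) : AEStronglyMeasurable (fun x : ℝ ↦ (w - (x : ℂ))⁻¹) μ :=
    (by fun_prop : Measurable fun x : ℝ ↦ (w - (x : ℂ))⁻¹).aestronglyMeasurable
  have hdist : ∀ᵐ x : ℝ ∂μ, ∀ w ∈ Metric.ball z (d / 2), d / 2 ≤ ‖w - (x : ℂ)‖ := by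
    filter_upwards [ae_infDist_le_norm_sub_ofReal hnull] with x hx w hw
    have h1 := Metric.infDist_le_infDist_add_dist (s := Complex.ofReal '' measureSupport μ)
      (x := z) (y := w)
    rw [Metric.mem_ball, dist_comm] at hw
    linarith [hx w]
  refine (hasDerivAt_integral_of_dominated_loc_of_deriv_le
    (F := fun w (x : ℝ) ↦ (w - (x : ℂ))⁻¹) (F' := fun w (x : ℝ) ↦ -1 / (w - (x : ℂ)) ^ 2)
    (bound := fun _ ↦ 1 / (d / 2) ^ 2) (Metric.ball_mem_nhds z (half_pos hz))
    (.of_forall hmeas) ?_ ?_ ?_ (integrable_const _) ?_).2.differentiableAt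
  · refine Integrable.of_bound (hmeas z) d⁻¹ ?_
    filter_upwards [ae_infDist_le_norm_sub_ofReal hnull] with x hx
    rw [norm_inv]
    exact inv_anti₀ hz (hx z)
  · exact (by fun_prop : Measurable fun x : ℝ ↦ -1 / (z - (x : ℂ)) ^ 2).aestronglyMeasurable
  · filter_upwards [hdist] with x hx w hw
    rw [norm_div, norm_neg, norm_one, norm_pow]
    have := hx w hw
    gcongr
  · filter_upwards [hdist] with x hx w hw
    have hne : w - (x : ℂ) ≠ 0 := norm_pos_iff.1 ((half_pos hz).trans_le (hx w hw))
    exact ((hasDerivAt_id w).sub_const (x : ℂ)).fun_inv hne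

lemma analyticAt_cauchyTransform [IsFiniteMeasure μ] (hnull : μ (measureSupport μ)ᶜ = 0)
    {z : ℂ} (hz : 0 < Metric.infDist z (Complex.ofReal '' measureSupport μ)) :
    AnalyticAt ℂ (cauchyTransform μ) z :=
  Complex.analyticAt_iff_eventually_differentiableAt.2 <|
    ((Metric.continuous_infDist_pt _).continuousAt.eventually_const_lt hz).mono
      fun _ hw ↦ differentiableAt_cauchyTransform hnull hw

end CauchyTransform

/-- Every complex number is the origin of a vertical ray on which the imaginary part grows
in absolute value. -/
lemma Complex.exists_vertical_ray (z : ℂ) :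
    ∃ σ : ℂ, σ.re = 0 ∧ ∀ t : ℝ, 0 ≤ t → t + |z.im| ≤ |(z + t * σ).im| := by
  rcases le_total 0 z.im with h | h
  · refine ⟨I, by simp, fun t _ ↦ ?_⟩
    simpa [abs_of_nonneg h, add_comm] using le_abs_self (z.im + t)
  · refine ⟨-I, by simp, fun t _ ↦ ?_⟩
    simpa [abs_of_nonpos h, add_comm] using neg_le_abs (z.im + -t)

lemma Complex.infDist_image_ofReal_le_of_re_eq {s : Set ℝ} (hs : s.Nonempty) {z w : ℂ}
    (hre : z.re = w.re) (him : |z.im| ≤ |w.im|) :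
    Metric.infDist z (Complex.ofReal '' s) ≤ Metric.infDist w (Complex.ofReal '' s) := by
  refine (Metric.le_infDist (hs.image _)).2 ?_
  rintro _ ⟨x, hx, rfl⟩
  refine (Metric.infDist_le_dist_of_mem (Set.mem_image_of_mem _ hx)).trans ?_
  rw [dist_eq_norm, dist_eq_norm, Complex.norm_def, Complex.norm_def]
  refine Real.sqrt_le_sqrt ?_
  have := sq_le_sq.2 him
  simp only [normSq_apply, sub_re, sub_im, ofReal_re, ofReal_im, hre]
  linarith

lemma Complex.abs_im_le_infDist_image_ofReal {s : Set ℝ} (hs : s.Nonempty) (z : ℂ) :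
    |z.im| ≤ Metric.infDist z (Complex.ofReal '' s) := by
  refine (Metric.le_infDist (hs.image _)).2 ?_
  rintro _ ⟨x, -, rfl⟩
  simpa [dist_eq_norm] using Complex.abs_im_le_norm (z - x)

/-- Let `μ` be a compactly supported Borel probability measure on `ℝ`,
`θ ∈ ℂ∖{0}` and `δ > 0`.  Then the set
`{ξ ∈ ℂ : dist(ξ, supp μ) ≥ δ and G_μ(ξ) = 1/θ}` is finite. -/
theorem setOf_cauchyTransform_eq_inv_finite
    (μ : Measure ℝ) [IsProbabilityMeasure μ]
    (hsupp : IsCompact (measureSupport μ)) (hnull : μ (measureSupport μ)ᶜ = 0)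
    (θ : ℂ) (hθ : θ ≠ 0) (δ : ℝ) (hδ : 0 < δ) :
    {ξ : ℂ | δ ≤ Metric.infDist ξ (Complex.ofReal '' measureSupport μ) ∧
      cauchyTransform μ ξ = 1 / θ}.Finite := by
  have hne : (measureSupport μ).Nonempty := by
    rw [Set.nonempty_iff_ne_empty]
    intro h
    simp [h] at hnull
  have hle {z : ℂ} (hz : cauchyTransform μ z = 1 / θ) :
      Metric.infDist z (Complex.ofReal '' measureSupport μ) ≤ ‖θ‖ := by
    by_contra! hlt
    have hpos := (norm_pos_iff.2 hθ).trans hlt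
    have h := norm_cauchyTransform_le hnull hpos le_rfl
    rw [hz, norm_div, norm_one, one_div] at h
    exact (inv_strictAnti₀ (norm_pos_iff.2 hθ) hlt).not_ge h
  have hK : IsCompact (Metric.cthickening ‖θ‖ (Complex.ofReal '' measureSupport μ)) :=
    (hsupp.image Complex.continuous_ofReal).cthickening
  by_contra hinf
  obtain ⟨z, -, hacc⟩ := Set.Infinite.exists_accPt_of_subset_isCompact hinf hK fun ξ hξ ↦ by
    rw [Metric.mem_cthickening_iff, ← ENNReal.ofReal_toReal
      (Metric.infEDist_ne_top (hne.image Complex.ofReal))]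
    exact ENNReal.ofReal_le_ofReal (hle hξ.2)
  have hfreq := accPt_iff_frequently_nhdsNE.1 hacc
  have hz : δ ≤ Metric.infDist z (Complex.ofReal '' measureSupport μ) :=
    (isClosed_le continuous_const (Metric.continuous_infDist_pt _)).mem_of_frequently_of_tendsto
      (hfreq.mono fun _ h ↦ h.1) (Filter.tendsto_id.mono_left nhdsWithin_le_nhds)
  obtain ⟨σ, hσ, hray⟩ := Complex.exists_vertical_ray z
  have hpre : IsPreconnected ((fun t : ℝ ↦ z + t * σ) '' Set.Ici 0) :=
    isPreconnected_Ici.image _ (by fun_prop)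
  have han : AnalyticOnNhd ℂ (cauchyTransform μ) ((fun t : ℝ ↦ z + t * σ) '' Set.Ici 0) := by
    rintro _ ⟨t, ht, rfl⟩
    refine analyticAt_cauchyTransform hnull (hδ.trans_le (hz.trans ?_))
    refine Complex.infDist_image_ofReal_le_of_re_eq hne (by simp [hσ]) ?_
    linarith [hray t ht, Set.mem_Ici.1 ht]
  have heq := han.eqOn_of_preconnected_of_frequently_eq (analyticOnNhd_const (v := 1 / θ)) hpre
    ⟨0, Set.self_mem_Ici, by simp⟩ (hfreq.mono fun _ h ↦ h.2)
  have ht : (0 : ℝ) ≤ ‖θ‖ + 1 := by positivity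
  have h1 := hle (heq ⟨‖θ‖ + 1, ht, rfl⟩)
  have h2 := Complex.abs_im_le_infDist_image_ofReal hne (z + (‖θ‖ + 1 : ℝ) * σ)
  linarith [hray _ ht, abs_nonneg z.im]
end

section
/- Let σ > 0 and let G_{μ_sc} be the Cauchy transform of the semicircle law of variance σ². Then for every z ∈ ℂ∖[−2σ, 2σ], σ²·G_{μ_sc}(z)² − z·G_{μ_sc}(z) + 1 = 0. -/
open MeasureTheory

/-- The semicircle law of variance `σ²`: the measure on `ℝ` with density
`x ↦ (1/(2πσ²))·√(4σ² − x²)` on `[−2σ, 2σ]`. -/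
noncomputable def semicircle (σ : ℝ) : Measure ℝ :=
  volume.withDensity fun x =>
    ENNReal.ofReal (Set.indicator (Set.Icc (-(2 * σ)) (2 * σ))
      (fun y => (2 * Real.pi * σ ^ 2)⁻¹ * Real.sqrt (4 * σ ^ 2 - y ^ 2)) x)

/-- A point off the segment `[-2σ, 2σ]` is the image under the Joukowski map
`w ↦ σ(w + w⁻¹)` of a point of the punctured open unit disc. -/
lemma exists_joukowski_preimage (σ : ℝ) (hσ : 0 < σ) (z : ℂ)
    (hz : z ∉ Complex.ofReal '' Set.Icc (-(2 * σ)) (2 * σ)) :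
    ∃ w : ℂ, w ≠ 0 ∧ ‖w‖ < 1 ∧ z = σ * (w + w⁻¹) := by
  have hσ' : (σ : ℂ) ≠ 0 := by exact_mod_cast hσ.ne'
  obtain ⟨s, hs⟩ := IsAlgClosed.exists_pow_nat_eq (z ^ 2 - 4 * (σ : ℂ) ^ 2) (n := 2) (by norm_num)
  set v : ℂ := (z + s) / (2 * σ) with hv
  have hprod : v * ((z - s) / (2 * σ)) = 1 := by
    rw [hv]
    field_simp
    linear_combination -hs
  have hv0 : v ≠ 0 := left_ne_zero_of_mul_eq_one hprod
  have hinv : v⁻¹ = (z - s) / (2 * σ) := inv_eq_of_mul_eq_one_right hprod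
  have hzv : z = σ * (v + v⁻¹) := by
    rw [hinv, hv]
    field_simp
    ring
  rcases lt_trichotomy ‖v‖ 1 with h | h | h
  · exact ⟨v, hv0, h, hzv⟩
  · refine absurd (⟨2 * σ * v.re, ?_, ?_⟩ :
      z ∈ Complex.ofReal '' Set.Icc (-(2 * σ)) (2 * σ)) hz
    · have := abs_le.1 ((Complex.abs_re_le_norm v).trans h.le)
      constructor <;> nlinarith
    · rw [hzv, Complex.inv_eq_conj h, Complex.add_conj]
      push_cast
      ring
  · refine ⟨v⁻¹, inv_ne_zero hv0, ?_, ?_⟩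
    · rw [norm_inv]
      exact inv_lt_one_of_one_lt₀ h
    · rw [inv_inv, hzv, add_comm]

lemma one_sub_mul_ne_zero_of_norm_lt_one {w u : ℂ} (hw : ‖w‖ < 1) (hu : ‖u‖ ≤ 1) :
    1 - w * u ≠ 0 := by
  intro h
  have h1 : ‖w * u‖ = 1 := by rw [← sub_eq_zero.1 h, norm_one]
  rw [norm_mul] at h1
  nlinarith [norm_nonneg w, norm_nonneg u]

/-- The integral of `sin² θ` against the Poisson-type kernel `1 / (1 - 2 w cos θ + w²)`. -/
lemma integral_sin_sq_mul_inv_one_sub_two_mul_cos (w : ℂ) (hw : ‖w‖ < 1) :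
    ∫ θ in (0 : ℝ)..Real.pi,
      (Real.sin θ : ℂ) ^ 2 * (1 - 2 * w * Real.cos θ + w ^ 2)⁻¹ = (Real.pi / 2 : ℂ) := by
  set F : ℂ → ℂ := fun u => (1 - u ^ 2) / (1 - w * u) with hF
  have hne : ∀ θ : ℝ, 1 - w * circleMap 0 1 θ ≠ 0 := fun θ =>
    one_sub_mul_ne_zero_of_norm_lt_one hw (by simp)
  have hdiff : ∀ u : ℂ, ‖u‖ ≤ 1 → DifferentiableAt ℂ F u := fun u hu =>
    (by fun_prop : DifferentiableAt ℂ (fun u : ℂ => 1 - u ^ 2) u).div (by fun_prop)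
      (one_sub_mul_ne_zero_of_norm_lt_one hw hu)
  have hmean : ∫ θ in (0 : ℝ)..2 * Real.pi, F (circleMap 0 1 θ) = 2 * Real.pi := by
    have h := circleAverage_of_differentiable_on_off_countable (f := F) (c := 0) (R := 1)
      Set.countable_empty
      (fun u hu => (hdiff u (by simpa using hu)).continuousAt.continuousWithinAt)
      (fun u hu => hdiff u (le_of_lt (by simpa using hu.1)))
    rw [Real.circleAverage_def, show F 0 = 1 by simp [hF],
      inv_smul_eq_iff₀ (by positivity)] at h
    simpa using h
  have hcont : Continuous fun θ : ℝ => F (circleMap 0 1 θ) :=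
    (by fun_prop : Continuous fun θ : ℝ => 1 - circleMap 0 1 θ ^ 2).div
      (by fun_prop) hne
  have hcont' : Continuous fun θ : ℝ => F (circleMap 0 1 (-θ)) := hcont.comp continuous_neg
  have hper : Function.Periodic (fun θ : ℝ => F (circleMap 0 1 θ)) (2 * Real.pi) := fun θ => by
    simp only [periodic_circleMap 0 1 θ]
  have hsym : ∫ θ in (0 : ℝ)..Real.pi, (F (circleMap 0 1 θ) + F (circleMap 0 1 (-θ)))
      = 2 * Real.pi := by
    rw [intervalIntegral.integral_add (hcont.intervalIntegrable _ _)
      (hcont'.intervalIntegrable _ _),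
      intervalIntegral.integral_comp_neg (fun θ => F (circleMap 0 1 θ)), neg_zero, add_comm,
      intervalIntegral.integral_add_adjacent_intervals (hcont.intervalIntegrable _ _)
      (hcont.intervalIntegrable _ _), ← hmean]
    have := hper.intervalIntegral_add_eq (-Real.pi) 0
    rwa [show -Real.pi + 2 * Real.pi = Real.pi by ring, zero_add] at this
  have hpt : ∀ θ : ℝ, (Real.sin θ : ℂ) ^ 2 * (1 - 2 * w * Real.cos θ + w ^ 2)⁻¹
      = 4⁻¹ * (F (circleMap 0 1 θ) + F (circleMap 0 1 (-θ))) := fun θ => by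
    have h1 := hne θ
    have h2 := hne (-θ)
    have huv : circleMap 0 1 θ * circleMap 0 1 (-θ) = 1 := by
      simp [circleMap, ← Complex.exp_add]
    have hcos : (Real.cos θ : ℂ) = (circleMap 0 1 θ + circleMap 0 1 (-θ)) / 2 := by
      simp [circleMap, Complex.cos]
    have hsin : (Real.sin θ : ℂ) ^ 2 = 1 - (Real.cos θ : ℂ) ^ 2 := by
      rw [← Complex.ofReal_pow, Real.sin_sq]
      push_cast
      rfl
    rw [hsin, hcos]
    generalize circleMap 0 1 θ = u at *
    generalize circleMap 0 1 (-θ) = v at *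
    have hden : 1 - 2 * w * ((u + v) / 2) + w ^ 2 = (1 - w * u) * (1 - w * v) := by
      linear_combination -w ^ 2 * huv
    have hsum : F u + F v = (2 - u ^ 2 - v ^ 2) / ((1 - w * u) * (1 - w * v)) := by
      simp only [hF]
      rw [div_add_div _ _ h1 h2]
      congr 1
      linear_combination w * (u + v) * huv
    rw [hden, hsum, div_eq_mul_inv]
    linear_combination -2⁻¹ * ((1 - w * u) * (1 - w * v))⁻¹ * huv
  rw [intervalIntegral.integral_congr fun θ _ => hpt θ, intervalIntegral.integral_const_mul, hsym]
  ring

/-- The Cauchy transform of the semicircle law in the Joukowski coordinate. -/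
lemma cauchyTransform_semicircle_joukowski (σ : ℝ) (hσ : 0 < σ) (w : ℂ) (hw0 : w ≠ 0)
    (hw : ‖w‖ < 1)
    (hz : (σ * (w + w⁻¹) : ℂ) ∉ Complex.ofReal '' Set.Icc (-(2 * σ)) (2 * σ)) :
    cauchyTransform (semicircle σ) (σ * (w + w⁻¹)) = w / σ := by
  have hσ' : (σ : ℂ) ≠ 0 := by exact_mod_cast hσ.ne'
  have hpi : (Real.pi : ℂ) ≠ 0 := by exact_mod_cast Real.pi_ne_zero
  set z : ℂ := σ * (w + w⁻¹) with hzdef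
  set g : ℝ → ℂ := fun x =>
    ((2 * Real.pi * σ ^ 2)⁻¹ * Real.sqrt (4 * σ ^ 2 - x ^ 2)) • (z - (x : ℂ))⁻¹ with hg
  have hG : cauchyTransform (semicircle σ) z = ∫ x in (-(2 * σ))..(2 * σ), g x := by
    have hmeas : Measurable fun y : ℝ =>
        (2 * Real.pi * σ ^ 2)⁻¹ * Real.sqrt (4 * σ ^ 2 - y ^ 2) := by fun_prop
    rw [cauchyTransform, semicircle, integral_withDensity_eq_integral_toReal_smul
      (hmeas.indicator measurableSet_Icc).ennreal_ofReal
      (Filter.Eventually.of_forall fun _ => ENNReal.ofReal_lt_top),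
      intervalIntegral.integral_of_le (by linarith), ← integral_Icc_eq_integral_Ioc,
      ← integral_indicator measurableSet_Icc]
    congr 1 with x
    rw [ENNReal.toReal_ofReal (Set.indicator_nonneg (fun _ _ => by positivity) x)]
    by_cases hx : x ∈ Set.Icc (-(2 * σ)) (2 * σ) <;> simp [hx, hg]
  have hgcont : ContinuousOn g (Set.Icc (-(2 * σ)) (2 * σ)) := by
    have hinv : ContinuousOn (fun x : ℝ => (z - (x : ℂ))⁻¹) (Set.Icc (-(2 * σ)) (2 * σ)) :=
      ContinuousOn.inv₀ (by fun_prop) fun x hx h => hz ⟨x, hx, (sub_eq_zero.1 h).symm⟩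
    have hdens : Continuous fun x : ℝ =>
        (2 * Real.pi * σ ^ 2)⁻¹ * Real.sqrt (4 * σ ^ 2 - x ^ 2) := by fun_prop
    exact hdens.continuousOn.smul hinv
  have hsub := intervalIntegral.integral_deriv_smul_comp' (a := Real.pi) (b := 0)
    (f := fun θ => 2 * σ * Real.cos θ) (f' := fun θ => 2 * σ * -Real.sin θ) (g := g)
    (fun θ _ => (Real.hasDerivAt_cos θ).const_mul (2 * σ)) (by fun_prop)
    (hgcont.mono (by
      rintro _ ⟨θ, -, rfl⟩
      constructor <;> nlinarith [Real.neg_one_le_cos θ, Real.cos_le_one θ]))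
  have hpt : ∀ θ ∈ Set.uIcc 0 Real.pi,
      (2 * σ * -Real.sin θ) • (g ∘ fun θ => 2 * σ * Real.cos θ) θ
        = -(2 * w / (Real.pi * σ)) *
          ((Real.sin θ : ℂ) ^ 2 * (1 - 2 * w * Real.cos θ + w ^ 2)⁻¹) := fun θ hθ => by
    rw [Set.uIcc_of_le Real.pi_pos.le] at hθ
    have hsqrt : Real.sqrt (4 * σ ^ 2 - (2 * σ * Real.cos θ) ^ 2) = 2 * σ * Real.sin θ := by
      rw [show 4 * σ ^ 2 - (2 * σ * Real.cos θ) ^ 2 = (2 * σ * Real.sin θ) ^ 2 by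
        rw [mul_pow _ (Real.sin θ), Real.sin_sq]; ring]
      exact Real.sqrt_sq (mul_nonneg (by positivity) (Real.sin_nonneg_of_mem_Icc hθ))
    have hker : z - ((2 * σ * Real.cos θ : ℝ) : ℂ)
        = σ / w * (1 - 2 * w * Real.cos θ + w ^ 2) := by
      rw [hzdef]
      push_cast
      field_simp
      ring
    simp only [hg, Function.comp_apply, hsqrt, hker, mul_inv (σ / w : ℂ), Complex.real_smul]
    generalize (1 - 2 * w * (Real.cos θ : ℂ) + w ^ 2)⁻¹ = K
    push_cast
    field_simp
  rw [Real.cos_pi, Real.cos_zero, mul_neg_one, mul_one] at hsub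
  rw [hG, ← hsub, intervalIntegral.integral_symm, intervalIntegral.integral_congr hpt,
    intervalIntegral.integral_const_mul, integral_sin_sq_mul_inv_one_sub_two_mul_cos w hw]
  field_simp

/-- For `σ > 0`, the Cauchy transform of the semicircle law of variance
`σ²` satisfies `σ²·G(z)² − z·G(z) + 1 = 0` for every `z ∈ ℂ∖[−2σ, 2σ]`. -/
theorem semicircle_cauchyTransform_quadratic (σ : ℝ) (hσ : 0 < σ)
    (z : ℂ) (hz : z ∉ Complex.ofReal '' Set.Icc (-(2 * σ)) (2 * σ)) :
    (σ : ℂ) ^ 2 * cauchyTransform (semicircle σ) z ^ 2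
      - z * cauchyTransform (semicircle σ) z + 1 = 0 := by
  obtain ⟨w, hw0, hw, rfl⟩ := exists_joukowski_preimage σ hσ z hz
  have hσ' : (σ : ℂ) ≠ 0 := by exact_mod_cast hσ.ne'
  rw [cauchyTransform_semicircle_joukowski σ hσ w hw0 hw hz]
  field_simp
  ring
end

section
/- Let (X₁,…,X_r) be a centered complex Gaussian vector. Then for all nonnegative integers p₁, q₁, …, p_r, q_r and every i ∈ {1,…,r} with p_i ≥ 1, the mixed moment M := E[X₁^{p₁}·X̄₁^{q₁}···X_r^{p_r}·X̄_r^{q_r}] satisfies M = (p_i − 1)·E[X_i²]·M(p_i → p_i − 2) + Σ_{j≠i} p_j·E[X_iX_j]·M(p_i → p_i − 1, p_j → p_j − 1) + Σ_{j=1}^{r} q_j·E[X_iX̄_j]·M(p_i → p_i − 1, q_j → q_j − 1), where M(·) denotes the same mixed moment with the indicated exponents decreased and with the convention that any term involving a negative exponent is zero. -/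
open MeasureTheory ProbabilityTheory Finset

/-- `(X₁,…,X_r)` is a centered complex Gaussian vector: every real linear combination of
the real and imaginary parts of its coordinates has a centered Gaussian law. -/
def IsCenteredComplexGaussianVec {Ω : Type*} [MeasurableSpace Ω] (P : Measure Ω)
    {r : ℕ} (X : Fin r → Ω → ℂ) : Prop :=
  ∀ a b : Fin r → ℝ, ∃ v : NNReal,
    Measure.map (fun ω => ∑ i, (a i * (X i ω).re + b i * (X i ω).im)) P =
      gaussianReal 0 v

/-- The mixed moment `E[X₁^{p₁} X̄₁^{q₁} ⋯ X_r^{p_r} X̄_r^{q_r}]`. -/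
noncomputable def mixedMoment {Ω : Type*} [MeasurableSpace Ω] (P : Measure Ω)
    {r : ℕ} (X : Fin r → Ω → ℂ) (p q : Fin r → ℕ) : ℂ :=
  ∫ ω, ∏ j, ((X j ω) ^ (p j) * (starRingEnd ℂ) (X j ω) ^ (q j)) ∂P


lemma Finset.prod_pow_update {ι M : Type*} [Fintype ι] [DecidableEq ι] [CommMonoid M]
    (a : ι → M) (n : ι → ℕ) (k : ι) (m : ℕ) :
    ∏ j, a j ^ Function.update n k m j = a k ^ m * ∏ j ∈ Finset.univ.erase k, a j ^ n j := by
  rw [← Finset.mul_prod_erase _ _ (Finset.mem_univ k), Function.update_self]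
  congr 1
  refine Finset.prod_congr rfl fun j hj ↦ ?_
  rw [Function.update_of_ne (Finset.ne_of_mem_erase hj)]

section Rotation

variable {E : Type*} [NormedAddCommGroup E] [NormedSpace ℝ E]

/-- The orbits of `ContinuousLinearMap.rotation` solve `(x, y)' = (y, -x)`. -/
lemma hasDerivAt_rotation (z : E × E) (θ : ℝ) :
    HasDerivAt (fun θ : ℝ ↦ ContinuousLinearMap.rotation θ z)
      ((ContinuousLinearMap.rotation θ z).2, -(ContinuousLinearMap.rotation θ z).1) θ := by
  simp only [ContinuousLinearMap.rotation_apply]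
  have hc := Real.hasDerivAt_cos θ
  have hs := Real.hasDerivAt_sin θ
  refine ((hc.smul_const z.1).add (hs.smul_const z.2)).prodMk
    ((hs.neg.smul_const z.1).add (hc.smul_const z.2)) |>.congr_deriv ?_
  ext <;> simp [neg_smul, add_comm]

lemma norm_rotation_le (θ : ℝ) (z : E × E) :
    ‖ContinuousLinearMap.rotation θ z‖ ≤ 2 * ‖z‖ := by
  have key : ∀ a b : ℝ, |a| ≤ 1 → |b| ≤ 1 → ‖a • z.1 + b • z.2‖ ≤ 2 * ‖z‖ := fun a b ha hb ↦
    calc ‖a • z.1 + b • z.2‖ ≤ |a| * ‖z.1‖ + |b| * ‖z.2‖ := by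
          simpa [norm_smul] using norm_add_le (a • z.1) (b • z.2)
      _ ≤ 1 * ‖z‖ + 1 * ‖z‖ := by
          gcongr
          exacts [norm_fst_le z, norm_snd_le z]
      _ = 2 * ‖z‖ := by ring
  rw [ContinuousLinearMap.rotation_apply, Prod.norm_mk]
  exact max_le (key _ _ (Real.abs_cos_le_one θ) (Real.abs_sin_le_one θ))
    (key _ _ (by simpa using Real.abs_sin_le_one θ) (Real.abs_cos_le_one θ))

end Rotation

section GaussianIntegrationByParts

variable {E : Type*} [NormedAddCommGroup E] [NormedSpace ℝ E] [CompleteSpace E]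
  [SecondCountableTopology E] [MeasurableSpace E] [BorelSpace E]

/-- Every polynomial in the norm is integrable for a Gaussian measure. -/
lemma integrable_one_add_mul_norm_pow (μ : Measure E) [IsGaussian μ] (C c : ℝ) (k : ℕ) :
    Integrable (fun x ↦ C * (1 + c * ‖x‖) ^ k) μ := by
  have hx : ∀ n : ℕ, Integrable (fun x : E ↦ ‖x‖ ^ n) μ := fun n ↦
    (IsGaussian.memLp_id μ n (by simp)).integrable_norm_pow'
  simp_rw [add_comm (1 : ℝ), add_pow, one_pow, mul_one, mul_pow]
  exact (integrable_finsetSum _ fun n _ ↦ ((hx n).const_mul _).mul_const _).const_mul _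

/-- Functions of temperate growth are integrable for Gaussian measures. -/
lemma Function.HasTemperateGrowth.integrable_of_isGaussian {μ : Measure E} [IsGaussian μ]
    {f : E → ℂ} (hf : f.HasTemperateGrowth) : Integrable f μ := by
  obtain ⟨k, C, hC⟩ := hf.2 0
  refine (integrable_one_add_mul_norm_pow μ C 1 k).mono'
    hf.1.continuous.aestronglyMeasurable (.of_forall fun x ↦ ?_)
  simpa using hC x

/-- Infinitesimal form of the rotation invariance of `μ.prod μ`, for `μ` a centered Gaussian
measure. -/
lemma integral_fderiv_rotation_eq_zero (μ : Measure E) [IsGaussian μ] (hμ : μ[id] = 0)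
    {h : E × E → ℂ} (hh : h.HasTemperateGrowth) :
    ∫ z, fderiv ℝ h z (z.2, -z.1) ∂(μ.prod μ) = 0 := by
  obtain ⟨k, C, hC⟩ := hh.2 1
  have hC0 : 0 ≤ C := by simpa using (norm_nonneg _).trans (hC 0)
  have hfd : Continuous (fderiv ℝ h) := hh.1.continuous_fderiv (by simp)
  have hcont : ∀ θ : ℝ, Continuous fun z : E × E ↦ h (ContinuousLinearMap.rotation θ z) :=
    fun θ ↦ hh.1.continuous.comp (ContinuousLinearMap.rotation θ).continuous
  have hconst : ∀ θ : ℝ, ∫ z, h (ContinuousLinearMap.rotation θ z) ∂(μ.prod μ) =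
      ∫ z, h z ∂(μ.prod μ) := fun θ ↦ by
    conv_rhs => rw [← IsGaussian.map_rotation_eq_self hμ θ]
    rw [integral_map (by fun_prop) hh.1.continuous.aestronglyMeasurable]
  have key := hasDerivAt_integral_of_dominated_loc_of_deriv_le (μ := μ.prod μ) (s := Set.univ)
    (x₀ := (0 : ℝ)) (F := fun θ z ↦ h (ContinuousLinearMap.rotation θ z))
    (F' := fun θ z ↦ fderiv ℝ h (ContinuousLinearMap.rotation θ z)
      ((ContinuousLinearMap.rotation θ z).2, -(ContinuousLinearMap.rotation θ z).1))
    (bound := fun z ↦ C * (1 + 2 * ‖z‖) ^ (k + 1)) Filter.univ_mem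
    (.of_forall fun θ ↦ (hcont θ).aestronglyMeasurable)
    (by simpa [ContinuousLinearMap.rotation_apply] using hh.integrable_of_isGaussian)
    (by
      refine Continuous.aestronglyMeasurable ?_
      fun_prop)
    (.of_forall fun z θ _ ↦ ?_) (integrable_one_add_mul_norm_pow _ _ _ _)
    (.of_forall fun z θ _ ↦ ?_)
  · simp_rw [hconst] at key
    simpa [ContinuousLinearMap.rotation_apply] using key.2.unique (hasDerivAt_const _ _)
  · set w := ContinuousLinearMap.rotation θ z
    have hw : ‖w‖ ≤ 2 * ‖z‖ := norm_rotation_le θ z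
    have hJ : ‖(w.2, -w.1)‖ ≤ 1 + 2 * ‖z‖ := by
      rw [Prod.norm_mk, norm_neg]
      exact max_le ((norm_snd_le w).trans (by linarith)) ((norm_fst_le w).trans (by linarith))
    have hfw : ‖fderiv ℝ h w‖ ≤ C * (1 + 2 * ‖z‖) ^ k := by
      rw [← norm_iteratedFDeriv_one]
      exact (hC w).trans (by gcongr)
    calc ‖fderiv ℝ h w (w.2, -w.1)‖ ≤ ‖fderiv ℝ h w‖ * ‖(w.2, -w.1)‖ :=
          ContinuousLinearMap.le_opNorm _ _
      _ ≤ C * (1 + 2 * ‖z‖) ^ k * (1 + 2 * ‖z‖) := by gcongr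
      _ = C * (1 + 2 * ‖z‖) ^ (k + 1) := by ring
  · exact ((hh.1.differentiable (by simp)) _).hasFDerivAt.comp_hasDerivAt θ
      (hasDerivAt_rotation z θ)

/-- **Wick's formula** for a centered Gaussian measure: Gaussian integration by parts for
a product of powers of linear maps. -/
lemma integral_mul_prod_pow_of_isGaussian (μ : Measure E) [IsGaussian μ] (hμ : μ[id] = 0)
    {ι : Type*} [Fintype ι] [DecidableEq ι] (ℓ₀ : E →L[ℝ] ℂ) (ℓ : ι → E →L[ℝ] ℂ) (n : ι → ℕ) :
    ∫ x, ℓ₀ x * ∏ j, ℓ j x ^ n j ∂μ =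
      ∑ k, n k * (∫ x, ℓ₀ x * ℓ k x ∂μ) *
        ∫ x, ∏ j, ℓ j x ^ Function.update n k (n k - 1) j ∂μ := by
  have hprod : ∀ m : ι → ℕ, Function.HasTemperateGrowth fun x ↦ ∏ j, ℓ j x ^ m j := fun m ↦ by
    induction (Finset.univ : Finset ι) using Finset.induction_on with
    | empty => simp
    | insert j s hj ih =>
      simp_rw [Finset.prod_insert hj]
      exact ((ℓ j).hasTemperateGrowth.pow _).mul ih
  have hfst : Function.HasTemperateGrowth fun z : E × E ↦ ∏ j, ℓ j z.1 ^ n j :=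
    (hprod n).comp (ContinuousLinearMap.fst ℝ E E).hasTemperateGrowth
  have hsnd : Function.HasTemperateGrowth fun z : E × E ↦ ℓ₀ z.2 :=
    (ℓ₀.comp (ContinuousLinearMap.snd ℝ E E)).hasTemperateGrowth
  have hderiv : ∀ z : E × E, fderiv ℝ (fun z : E × E ↦ ℓ₀ z.2 * ∏ j, ℓ j z.1 ^ n j) z (z.2, -z.1) =
      ∑ k, n k * ((∏ j, ℓ j z.1 ^ Function.update n k (n k - 1) j) * (ℓ₀ z.2 * ℓ k z.2)) -
        ℓ₀ z.1 * ∏ j, ℓ j z.1 ^ n j := fun z ↦ by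
    have h₀ : HasFDerivAt (fun z : E × E ↦ ℓ₀ z.2)
        (ℓ₀.comp (ContinuousLinearMap.snd ℝ E E)) z :=
      (ℓ₀.comp (ContinuousLinearMap.snd ℝ E E)).hasFDerivAt
    have hk : ∀ k ∈ (Finset.univ : Finset ι), HasFDerivAt (fun z : E × E ↦ ℓ k z.1 ^ n k) _ z :=
      fun k _ ↦ ((ℓ k).comp (ContinuousLinearMap.fst ℝ E E)).hasFDerivAt.pow (n k)
    rw [(h₀.fun_mul (HasFDerivAt.finsetProd hk)).fderiv]
    simp only [FunLike.coe_add, FunLike.coe_smul, Pi.add_apply, Pi.smul_apply, smul_eq_mul,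
      _root_.sum_apply, ContinuousLinearMap.comp_apply,
      ContinuousLinearMap.coe_fst', ContinuousLinearMap.coe_snd', map_neg, Finset.mul_sum]
    rw [sub_eq_add_neg]
    congr 1
    · refine Finset.sum_congr rfl fun k _ ↦ ?_
      rw [Finset.prod_pow_update, nsmul_eq_mul]
      ring
    · ring
  have hpair : ∀ k, Integrable (fun y ↦ ℓ₀ y * ℓ k y) μ := fun k ↦
    (ℓ₀.hasTemperateGrowth.mul (ℓ k).hasTemperateGrowth).integrable_of_isGaussian
  have hterm : ∀ k, Integrable (fun z : E × E ↦ (n k : ℂ) *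
      ((∏ j, ℓ j z.1 ^ Function.update n k (n k - 1) j) * (ℓ₀ z.2 * ℓ k z.2))) (μ.prod μ) :=
    fun k ↦ ((hprod _).integrable_of_isGaussian.mul_prod (hpair k)).const_mul _
  have hleft : Integrable (fun x ↦ ℓ₀ x * ∏ j, ℓ j x ^ n j) μ :=
    (ℓ₀.hasTemperateGrowth.mul (hprod n)).integrable_of_isGaussian
  have key := integral_fderiv_rotation_eq_zero μ hμ (hsnd.mul hfst)
  simp only [Pi.mul_def] at key
  simp_rw [hderiv] at key
  rw [integral_sub (integrable_finsetSum _ fun k _ ↦ hterm k) (hleft.comp_fst μ),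
    integral_fun_fst (f := fun x ↦ ℓ₀ x * ∏ j, ℓ j x ^ n j), integral_finsetSum _ fun k _ ↦ hterm k,
    sub_eq_zero] at key
  simp only [probReal_univ, one_smul] at key
  rw [← key]
  refine Finset.sum_congr rfl fun k _ ↦ ?_
  rw [integral_const_mul, integral_prod_mul (fun x ↦ ∏ j, ℓ j x ^ Function.update n k (n k - 1) j)
    (fun y ↦ ℓ₀ y * ℓ k y)]
  ring

end GaussianIntegrationByParts

namespace IsCenteredComplexGaussianVec

variable {Ω : Type*} [MeasurableSpace Ω] {P : Measure Ω} {r : ℕ} {X : Fin r → Ω → ℂ}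

/-- Every real linear form of a centered complex Gaussian vector is a centered real Gaussian. -/
lemma exists_map_eq_gaussianReal (hX : ∀ i, AEMeasurable (X i) P)
    (h : IsCenteredComplexGaussianVec P X) (L : (Fin r → ℂ) →L[ℝ] ℝ) :
    ∃ v : NNReal, (P.map fun ω i ↦ X i ω).map L = gaussianReal 0 v := by
  obtain ⟨v, hv⟩ := h (fun i ↦ L (Pi.single i 1)) (fun i ↦ L (Pi.single i Complex.I))
  refine ⟨v, ?_⟩
  rw [AEMeasurable.map_map_of_aemeasurable (by fun_prop) (aemeasurable_pi_lambda _ hX), ← hv]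
  congr 1
  ext ω
  have hsum : (fun i ↦ X i ω) = ∑ i, ((X i ω).re • (Pi.single i 1 : Fin r → ℂ) +
      (X i ω).im • (Pi.single i Complex.I : Fin r → ℂ)) := by
    ext j
    simp [Finset.sum_apply, Pi.single_apply, Finset.sum_add_distrib]
  rw [Function.comp_apply, hsum]
  simp [mul_comm]

lemma isGaussian_map (hX : ∀ i, AEMeasurable (X i) P)
    (h : IsCenteredComplexGaussianVec P X) : IsGaussian (P.map fun ω i ↦ X i ω) :=
  isGaussian_of_map_eq_gaussianReal fun L ↦ ⟨0, h.exists_map_eq_gaussianReal hX L⟩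

lemma integral_id_map_eq_zero (hX : ∀ i, AEMeasurable (X i) P)
    (h : IsCenteredComplexGaussianVec P X) : (P.map fun ω i ↦ X i ω)[id] = 0 := by
  have := h.isGaussian_map hX
  refine SeparatingDual.eq_zero_of_forall_dual_eq_zero (R := ℝ) fun L ↦ ?_
  obtain ⟨v, hv⟩ := h.exists_map_eq_gaussianReal hX L
  have hmap := integral_map (μ := P.map fun ω i ↦ X i ω) (φ := L) (f := id)
    (by fun_prop) (by fun_prop)
  rw [hv] at hmap
  simpa [IsGaussian.integral_dual] using hmap.symm

end IsCenteredComplexGaussianVec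

/-- Wick-type recurrence for the mixed moments of a centered complex
Gaussian vector `(X₁,…,X_r)`: if `p_i ≥ 1` then
`M = (p_i − 1) E[X_i²] M(p_i → p_i − 2) + Σ_{j≠i} p_j E[X_iX_j] M(p_i → p_i−1, p_j → p_j−1)
 + Σ_j q_j E[X_i X̄_j] M(p_i → p_i−1, q_j → q_j−1)`,
with the convention that any term involving a negative exponent vanishes (here the
corresponding coefficient vanishes). -/
theorem complexGaussianVec_mixedMoment_rec {Ω : Type*} [MeasurableSpace Ω] (P : Measure Ω)
    [IsProbabilityMeasure P] {r : ℕ} (X : Fin r → Ω → ℂ)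
    (hXmeas : ∀ i, AEMeasurable (X i) P)
    (hGauss : IsCenteredComplexGaussianVec P X)
    (p q : Fin r → ℕ) (i : Fin r) (hpi : 1 ≤ p i) :
    mixedMoment P X p q =
      ((p i : ℂ) - 1) * (∫ ω, (X i ω) ^ 2 ∂P) *
          mixedMoment P X (Function.update p i (p i - 2)) q
        + ∑ j ∈ Finset.univ.erase i,
            (p j : ℂ) * (∫ ω, X i ω * X j ω ∂P) *
              mixedMoment P X
                (Function.update (Function.update p i (p i - 1)) j (p j - 1)) q
        + ∑ j, (q j : ℂ) * (∫ ω, X i ω * (starRingEnd ℂ) (X j ω) ∂P) *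
            mixedMoment P X (Function.update p i (p i - 1))
              (Function.update q j (q j - 1)) := by
  classical
  have hX : AEMeasurable (fun ω i ↦ X i ω) P := aemeasurable_pi_lambda _ hXmeas
  have := hGauss.isGaussian_map hXmeas
  let π (j : Fin r) : (Fin r → ℂ) →L[ℝ] ℂ := ContinuousLinearMap.proj j
  let ℓ : Fin r ⊕ Fin r → (Fin r → ℂ) →L[ℝ] ℂ :=
    Sum.elim π fun j ↦ Complex.conjCLE.toContinuousLinearMap.comp (π j)
  have htransfer : ∀ f : (Fin r → ℂ) → ℂ, Continuous f →
      ∫ x, f x ∂(P.map fun ω i ↦ X i ω) = ∫ ω, f (fun i ↦ X i ω) ∂P :=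
    fun f hf ↦ integral_map hX hf.aestronglyMeasurable
  have hmoment : ∀ p q : Fin r → ℕ,
      ∫ x, ∏ k, ℓ k x ^ Sum.elim p q k ∂(P.map fun ω i ↦ X i ω) = mixedMoment P X p q :=
    fun p q ↦ by
      rw [htransfer _ (by fun_prop)]
      simp [mixedMoment, ℓ, π, Finset.prod_mul_distrib]
  have hleft : ∫ x, π i x * ∏ k, ℓ k x ^ Sum.elim (Function.update p i (p i - 1)) q k
      ∂(P.map fun ω i ↦ X i ω) = mixedMoment P X p q := by
    rw [← hmoment]
    refine integral_congr_ae (.of_forall fun x ↦ ?_)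
    simp only [Fintype.prod_sum_type, Sum.elim_inl, Sum.elim_inr, ← mul_assoc]
    congr 1
    rw [Finset.prod_pow_update (fun j ↦ ℓ (Sum.inl j) x),
      ← Finset.mul_prod_erase _ _ (Finset.mem_univ i), ← mul_assoc]
    congr 1
    exact mul_pow_sub_one (by lia) _
  have hcov : ∀ k, ∫ x, π i x * ℓ k x ∂(P.map fun ω i ↦ X i ω) =
      ∫ ω, π i (fun i ↦ X i ω) * ℓ k (fun i ↦ X i ω) ∂P := fun k ↦ htransfer _ (by fun_prop)
  rw [← hleft, integral_mul_prod_pow_of_isGaussian _ (hGauss.integral_id_map_eq_zero hXmeas)]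
  simp only [Fintype.sum_sum_type, Sum.elim_inl, Sum.elim_inr, Sum.update_elim_inl,
    Sum.update_elim_inr, hmoment, hcov]
  rw [← Finset.add_sum_erase _ _ (Finset.mem_univ i)]
  congr 1
  congr 1
  · simp [ℓ, π, ← sq, Nat.cast_sub hpi, Nat.sub_sub]
  · refine Finset.sum_congr rfl fun j hj ↦ ?_
    rw [Function.update_of_ne (Finset.ne_of_mem_erase hj)]
    simp [ℓ, π]
end
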